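/- arXiv:1511.00065 — 3 statements merged into one kernel-verified Lean document; each statement's English description precedes it below -/
import Mathlib

section
/- (Two one-sided solutions of the limiting HJB problem) Suppose k∞ > 0 satisfies f′(k∞) ≠ δ − u₂′(f(k∞),k∞)/u₁′(f(k∞),k∞). Then the boundary-value problem (81)–(82), namely (f(k)−φ₀(V′(k),k))·V′(k) + u(φ₀(V′(k),k),k) = δ·V(k) with V(k∞) = (1/δ)·u(f(k∞),k∞), has two solutions V₁ ≠ V₂ defined on a non-empty half-interval of the form [k∞, k∞+a) or (k∞−a, k∞]; both are C¹ on the half-interval, C² on its interior, and they have the same one-sided derivative at k∞, given by V₁′(k∞) = V₂′(k∞) = u₁′(f(k∞),k∞), i.e. φ₀(Vᵢ′(k∞),k∞) = f(k∞) for i=1,2. Moreover, the half-interval lies to the left of k∞ if δ − f′(k∞) − u₂′(f(k∞),k∞)/u₁′(f(k∞),k∞) < 0, and to the right if this quantity is positive. -/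
open Filter Set

noncomputable def pd1 (u : ℝ → ℝ → ℝ) (c k : ℝ) : ℝ := deriv (fun x => u x k) c
noncomputable def pd2 (u : ℝ → ℝ → ℝ) (c k : ℝ) : ℝ := deriv (fun y => u c y) k
noncomputable def pd11 (u : ℝ → ℝ → ℝ) (c k : ℝ) : ℝ := deriv (fun x => pd1 u x k) c

/-- A pair of distinct one-sided solutions of the boundary-value problem (81)–(82) on the
half-interval `J` limited by `kinf`: both are `C¹` up to the endpoint (with one-sided
derivatives `g₁`, `g₂`), `C²` on the interior, solve
`(f(k)−φ₀(V'(k),k))·V'(k) + u(φ₀(V'(k),k),k) = δ·V(k)` with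
`V(kinf) = u(f(kinf),kinf)/δ`, and share the derivative `u₁'(f(kinf),kinf)` at `kinf`. -/
def SolPair (f : ℝ → ℝ) (u : ℝ → ℝ → ℝ) (φ : ℝ → ℝ → ℝ) (δ kinf : ℝ)
    (J : Set ℝ) : Prop :=
  ∃ V₁ V₂ g₁ g₂ : ℝ → ℝ,
    (∀ k ∈ J, HasDerivWithinAt V₁ (g₁ k) J k) ∧ ContinuousOn g₁ J ∧
    (∀ k ∈ J, HasDerivWithinAt V₂ (g₂ k) J k) ∧ ContinuousOn g₂ J ∧
    ContDiffOn ℝ 2 V₁ (interior J) ∧ ContDiffOn ℝ 2 V₂ (interior J) ∧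
    (∀ k ∈ J, (f k - φ (g₁ k) k) * g₁ k + u (φ (g₁ k) k) k = δ * V₁ k) ∧
    (∀ k ∈ J, (f k - φ (g₂ k) k) * g₂ k + u (φ (g₂ k) k) k = δ * V₂ k) ∧
    V₁ kinf = u (f kinf) kinf / δ ∧ V₂ kinf = u (f kinf) kinf / δ ∧
    g₁ kinf = pd1 u (f kinf) kinf ∧ g₂ kinf = pd1 u (f kinf) kinf ∧
    φ (g₁ kinf) kinf = f kinf ∧ φ (g₂ kinf) kinf = f kinf ∧
    ¬ Set.EqOn V₁ V₂ J

/-- `τ` is a right inverse on `J`, with values in `S`, of the first component of a curve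
`t ↦ (K t, P t, Q t)`, and along it `Q` is a `C¹` function of `K` (`C²` in the interior) whose
derivative is `P`. -/
structure IsBranch (K P Q : ℝ → ℝ) (S J : Set ℝ) (τ : ℝ → ℝ) : Prop where
  mem : ∀ k ∈ J, τ k ∈ S
  right_inv : ∀ k ∈ J, K (τ k) = k
  base : τ (K 0) = 0
  hasDerivWithinAt : ∀ k ∈ J, HasDerivWithinAt (fun y => Q (τ y)) (P (τ k)) J k
  continuousOn : ContinuousOn (fun y => P (τ y)) J
  contDiffOn : ContDiffOn ℝ 2 (fun y => Q (τ y)) (interior J)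

theorem StrictMonoOn.exists_continuousOn_inverse {K : ℝ → ℝ} {b : ℝ} (hb : 0 ≤ b)
    (hK : ContinuousOn K (Icc 0 b)) (hmono : StrictMonoOn K (Icc 0 b)) :
    ∃ τ : ℝ → ℝ, (∀ t ∈ Icc 0 b, τ (K t) = t) ∧ (∀ k ∈ Icc (K 0) (K b), τ k ∈ Icc 0 b) ∧
      (∀ k ∈ Icc (K 0) (K b), K (τ k) = k) ∧ ContinuousOn τ (Icc (K 0) (K b)) := by
  have himg : K '' Icc 0 b = Icc (K 0) (K b) := by
    apply Subset.antisymm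
    · rintro _ ⟨t, ht, rfl⟩
      exact ⟨hmono.monotoneOn (left_mem_Icc.2 hb) ht ht.1,
        hmono.monotoneOn ht (right_mem_Icc.2 hb) ht.2⟩
    · exact intermediate_value_Icc hb hK
  have hinv : LeftInvOn (Function.invFunOn K (Icc 0 b)) K (Icc 0 b) :=
    hmono.injOn.leftInvOn_invFunOn
  have hmem : ∀ k ∈ Icc (K 0) (K b), Function.invFunOn K (Icc 0 b) k ∈ Icc 0 b := by
    intro k hk
    rw [← himg] at hk
    exact Function.invFunOn_mem hk
  have hright : ∀ k ∈ Icc (K 0) (K b), K (Function.invFunOn K (Icc 0 b) k) = k := by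
    intro k hk
    rw [← himg] at hk
    exact Function.invFunOn_eq hk
  refine ⟨Function.invFunOn K (Icc 0 b), hinv, hmem, hright, ?_⟩
  have : OrdConnected (K '' Icc 0 b) := himg ▸ ordConnected_Icc
  have hc := (hmono.orderIso K (Icc 0 b)).symm.continuous
  rw [← himg, continuousOn_iff_continuous_domRestrict]
  convert continuous_subtype_val.comp hc using 1
  ext ⟨_, t, ht, rfl⟩
  have : (hmono.orderIso K (Icc 0 b)).symm ⟨K t, mem_image_of_mem K ht⟩ = ⟨t, ht⟩ := by
    rw [OrderIso.symm_apply_eq]; rfl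
  simp only [domRestrict_apply, Function.comp_apply, this]
  exact hinv ht

theorem eventually_exists_isBranch_right {K P Q : ℝ → ℝ} {ε : ℝ} (hε : 0 < ε)
    (hKc : ContinuousOn K (Ico 0 ε)) (hPc : ContinuousOn P (Ico 0 ε))
    (hQc : ContinuousOn Q (Ico 0 ε))
    (hK : ContDiffOn ℝ 1 K (Ioo 0 ε)) (hP : ContDiffOn ℝ 1 P (Ioo 0 ε))
    (hK' : ∀ t ∈ Ioo 0 ε, 0 < deriv K t)
    (hQ : ∀ t ∈ Ioo 0 ε, HasDerivAt Q (P t * deriv K t) t) :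
    ∀ᶠ a in nhdsWithin 0 (Ioi 0), ∃ τ, IsBranch K P Q (Ico 0 ε) (Ico (K 0) (K 0 + a)) τ := by
  obtain ⟨b, hb, hbε⟩ := exists_between hε
  have hsub : Icc 0 b ⊆ Ico 0 ε := Icc_subset_Ico_right hbε
  have hmono : StrictMonoOn K (Icc 0 b) := by
    apply strictMonoOn_of_deriv_pos (convex_Icc _ _) (hKc.mono hsub)
    rw [interior_Icc]
    exact fun t ht => hK' t ⟨ht.1, ht.2.trans hbε⟩
  obtain ⟨τ, hleft, hmem, hright, hτc⟩ :=
    StrictMonoOn.exists_continuousOn_inverse hb.le (hKc.mono hsub) hmono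
  have hKb : K 0 < K b := hmono (left_mem_Icc.2 hb.le) (right_mem_Icc.2 hb.le) hb
  have hev : ∀ᶠ a in nhdsWithin (0 : ℝ) (Ioi 0), a ∈ Ioo 0 (K b - K 0) :=
    Ioo_mem_nhdsGT (sub_pos.2 hKb)
  filter_upwards [hev] with a ha
  refine ⟨τ, ?_⟩
  have hJ : Ico (K 0) (K 0 + a) ⊆ Icc (K 0) (K b) := fun k hk =>
    ⟨hk.1, by linarith [hk.2, ha.2]⟩
  have hbase : τ (K 0) = 0 := hleft 0 (left_mem_Icc.2 hb.le)
  have hmemI : ∀ k ∈ Ioo (K 0) (K 0 + a), τ k ∈ Ioo 0 ε := by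
    intro k hk
    have h1 := hmem k (hJ ⟨hk.1.le, hk.2⟩)
    refine ⟨lt_of_le_of_ne h1.1 fun h => ?_, h1.2.trans_lt hbε⟩
    have h2 := hright k (hJ ⟨hk.1.le, hk.2⟩)
    rw [← h] at h2
    exact hk.1.ne h2
  have hτcI : ∀ k ∈ Ioo (K 0) (K 0 + a), ContinuousAt τ k := fun k hk =>
    hτc.continuousAt (Icc_mem_nhds hk.1 (by linarith [hk.2, ha.2]))
  have hKd : ∀ t ∈ Ioo 0 ε, HasDerivAt K (deriv K t) t := fun t ht =>
    ((hK.differentiableOn one_ne_zero).differentiableAt (isOpen_Ioo.mem_nhds ht)).hasDerivAt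
  have hτd : ∀ k ∈ Ioo (K 0) (K 0 + a), HasDerivAt τ (deriv K (τ k))⁻¹ k := by
    intro k hk
    refine HasDerivAt.of_local_left_inverse (hτcI k hk) (hKd _ (hmemI k hk))
      (hK' _ (hmemI k hk)).ne' ?_
    filter_upwards [isOpen_Ioo.mem_nhds hk] with y hy using hright y (hJ ⟨hy.1.le, hy.2⟩)
  have hτ1 : ContDiffOn ℝ 1 τ (Ioo (K 0) (K 0 + a)) := by
    rw [show (1 : WithTop ℕ∞) = 0 + 1 from rfl, contDiffOn_succ_iff_deriv_of_isOpen isOpen_Ioo]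
    refine ⟨fun k hk => (hτd k hk).differentiableAt.differentiableWithinAt, by simp, ?_⟩
    rw [contDiffOn_zero]
    have : ContinuousOn (fun k => (deriv K (τ k))⁻¹) (Ioo (K 0) (K 0 + a)) :=
      ((hK.continuousOn_deriv_of_isOpen isOpen_Ioo le_rfl).comp
        (fun k hk => (hτcI k hk).continuousWithinAt) hmemI).inv₀
        fun k hk => (hK' _ (hmemI k hk)).ne'
    exact this.congr fun k hk => (hτd k hk).deriv
  have hQd : ∀ k ∈ Ioo (K 0) (K 0 + a), HasDerivAt (fun y => Q (τ y)) (P (τ k)) k := by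
    intro k hk
    have := (hQ _ (hmemI k hk)).comp k (hτd k hk)
    rwa [mul_assoc, mul_inv_cancel₀ (hK' _ (hmemI k hk)).ne', mul_one] at this
  have hPτ : ContinuousOn (fun y => P (τ y)) (Ico (K 0) (K 0 + a)) :=
    hPc.comp (hτc.mono hJ) fun k hk => hsub (hmem k (hJ hk))
  have hQτ : ContinuousOn (fun y => Q (τ y)) (Ico (K 0) (K 0 + a)) :=
    hQc.comp (hτc.mono hJ) fun k hk => hsub (hmem k (hJ hk))
  have hlt : K 0 < K 0 + a := by linarith [ha.1]
  refine ⟨fun k hk => hsub (hmem k (hJ hk)), fun k hk => hright k (hJ hk), hbase, ?_, hPτ, ?_⟩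
  · intro k hk
    rcases hk.1.eq_or_lt with rfl | h
    · refine HasDerivWithinAt.mono (t := Ici (K 0)) ?_ Ico_subset_Ici_self
      apply hasDerivWithinAt_Ici_of_tendsto_deriv (s := Ioo (K 0) (K 0 + a))
      · exact fun k hk => (hQd k hk).differentiableAt.differentiableWithinAt
      · exact (hQτ _ hk).mono Ioo_subset_Ico_self
      · exact Ioo_mem_nhdsGT hlt
      · have h1 : Tendsto (fun y => P (τ y)) (nhdsWithin (K 0) (Ioi (K 0)))
            (nhds (P (τ (K 0)))) := by
          have h2 := (hPτ _ hk).mono Ioo_subset_Ico_self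
          rwa [ContinuousWithinAt, nhdsWithin_Ioo_eq_nhdsGT hlt] at h2
        refine h1.congr' ?_
        filter_upwards [Ioo_mem_nhdsGT hlt] with y hy using (hQd y hy).deriv.symm
    · exact (hQd k ⟨h, hk.2⟩).hasDerivWithinAt
  · rw [interior_Ico, show (2 : WithTop ℕ∞) = 1 + 1 from by norm_num,
      contDiffOn_succ_iff_deriv_of_isOpen isOpen_Ioo]
    refine ⟨fun k hk => (hQd k hk).differentiableAt.differentiableWithinAt, by simp, ?_⟩
    exact (hP.comp hτ1 hmemI).congr fun k hk => (hQd k hk).deriv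

theorem eventually_exists_isBranch_left {K P Q : ℝ → ℝ} {ε : ℝ} (hε : 0 < ε)
    (hKc : ContinuousOn K (Ico 0 ε)) (hPc : ContinuousOn P (Ico 0 ε))
    (hQc : ContinuousOn Q (Ico 0 ε))
    (hK : ContDiffOn ℝ 1 K (Ioo 0 ε)) (hP : ContDiffOn ℝ 1 P (Ioo 0 ε))
    (hK' : ∀ t ∈ Ioo 0 ε, deriv K t < 0)
    (hQ : ∀ t ∈ Ioo 0 ε, HasDerivAt Q (P t * deriv K t) t) :
    ∀ᶠ a in nhdsWithin 0 (Ioi 0), ∃ τ, IsBranch K P Q (Ico 0 ε) (Ioc (K 0 - a) (K 0)) τ := by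
  have hd : ∀ t, deriv (fun s => -K s) t = -deriv K t := fun t => deriv.fun_neg
  have := eventually_exists_isBranch_right (K := fun t => -K t) (P := fun t => -P t) (Q := Q) hε
    hKc.neg hPc.neg hQc hK.neg hP.neg (fun t ht => by rw [hd]; linarith [hK' t ht])
    (fun t ht => by rw [hd, neg_mul_neg]; exact hQ t ht)
  filter_upwards [this] with a ⟨τ, h⟩
  have hmaps : MapsTo (fun k : ℝ => -k) (Ioc (K 0 - a) (K 0)) (Ico (-K 0) (-K 0 + a)) :=
    fun k hk => ⟨by linarith [hk.2], by linarith [hk.1]⟩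
  refine ⟨fun k => τ (-k), fun k hk => h.mem _ (hmaps hk), fun k hk => ?_, h.base, fun k hk => ?_,
    ?_, ?_⟩
  · linarith [h.right_inv _ (hmaps hk)]
  · have := (h.hasDerivWithinAt _ (hmaps hk)).comp k (hasDerivAt_neg k).hasDerivWithinAt hmaps
    simpa [Function.comp_def] using this
  · exact (h.continuousOn.comp continuous_neg.continuousOn hmaps).neg.congr
      fun k _ => (neg_neg _).symm
  · refine h.contDiffOn.comp contDiff_neg.contDiffOn ?_
    rw [interior_Ico, interior_Ioc]
    exact fun k hk => ⟨by linarith [hk.2], by linarith [hk.1]⟩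

theorem pd1_eq_fderiv {u : ℝ → ℝ → ℝ} {p : ℝ × ℝ}
    (hu : DifferentiableAt ℝ (fun p : ℝ × ℝ => u p.1 p.2) p) :
    pd1 u p.1 p.2 = fderiv ℝ (fun p : ℝ × ℝ => u p.1 p.2) p (1, 0) :=
  (HasFDerivAt.comp_hasDerivAt (l := fun q : ℝ × ℝ => u q.1 q.2) (f := fun x => (x, p.2)) p.1
    hu.hasFDerivAt ((hasDerivAt_id p.1).prodMk (hasDerivAt_const p.1 p.2))).deriv

theorem pd2_eq_fderiv {u : ℝ → ℝ → ℝ} {p : ℝ × ℝ}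
    (hu : DifferentiableAt ℝ (fun p : ℝ × ℝ => u p.1 p.2) p) :
    pd2 u p.1 p.2 = fderiv ℝ (fun p : ℝ × ℝ => u p.1 p.2) p (0, 1) :=
  (HasFDerivAt.comp_hasDerivAt (l := fun q : ℝ × ℝ => u q.1 q.2) (f := fun y => (p.1, y)) p.2
    hu.hasFDerivAt ((hasDerivAt_const p.2 p.1).prodMk (hasDerivAt_id p.2))).deriv

theorem contDiffOn_pd1 {u : ℝ → ℝ → ℝ} {Ω : Set (ℝ × ℝ)} (hΩ : IsOpen Ω)
    (hu : ContDiffOn ℝ (⊤ : ℕ∞) (fun p : ℝ × ℝ => u p.1 p.2) Ω) :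
    ContDiffOn ℝ (⊤ : ℕ∞) (fun p : ℝ × ℝ => pd1 u p.1 p.2) Ω := by
  have h := (hu.fderiv_of_isOpen (m := (⊤ : ℕ∞)) hΩ (by simp)).clm_apply
    (contDiffOn_const (c := ((1, 0) : ℝ × ℝ)))
  exact h.congr fun p hp =>
    pd1_eq_fderiv ((hu.differentiableOn (by simp)).differentiableAt (hΩ.mem_nhds hp))

theorem contDiffOn_pd2 {u : ℝ → ℝ → ℝ} {Ω : Set (ℝ × ℝ)} (hΩ : IsOpen Ω)
    (hu : ContDiffOn ℝ (⊤ : ℕ∞) (fun p : ℝ × ℝ => u p.1 p.2) Ω) :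
    ContDiffOn ℝ (⊤ : ℕ∞) (fun p : ℝ × ℝ => pd2 u p.1 p.2) Ω := by
  have h := (hu.fderiv_of_isOpen (m := (⊤ : ℕ∞)) hΩ (by simp)).clm_apply
    (contDiffOn_const (c := ((0, 1) : ℝ × ℝ)))
  exact h.congr fun p hp =>
    pd2_eq_fderiv ((hu.differentiableOn (by simp)).differentiableAt (hΩ.mem_nhds hp))

theorem hasDerivAt_comp_pd {u : ℝ → ℝ → ℝ} {Ω : Set (ℝ × ℝ)} (hΩ : IsOpen Ω)
    (hu : ContDiffOn ℝ (⊤ : ℕ∞) (fun p : ℝ × ℝ => u p.1 p.2) Ω) {c K : ℝ → ℝ} {c' K' t : ℝ}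
    (hc : HasDerivAt c c' t) (hK : HasDerivAt K K' t) (ht : (c t, K t) ∈ Ω) :
    HasDerivAt (fun s => u (c s) (K s)) (pd1 u (c t) (K t) * c' + pd2 u (c t) (K t) * K') t := by
  have hd := (hu.differentiableOn (by simp)).differentiableAt (hΩ.mem_nhds ht)
  have h := hd.hasFDerivAt.comp_hasDerivAt t (hc.prodMk hK)
  have hlin : ((c', K') : ℝ × ℝ) = c' • (1, 0) + K' • (0, 1) := by simp
  rw [hlin, map_add, map_smul, map_smul, ← pd1_eq_fderiv hd, ← pd2_eq_fderiv hd] at h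
  exact h.congr_deriv (by simp [mul_comm])

theorem HasDerivAt.eventually_mul_neg {e : ℝ → ℝ} {D : ℝ} (he : HasDerivAt e (-D) 0)
    (h0 : e 0 = 0) (hD : D ≠ 0) : ∀ᶠ t in nhds 0, t ≠ 0 → D * t * e t < 0 := by
  have h1 : Tendsto (fun t => D * slope e 0 t) (nhdsWithin 0 {0}ᶜ) (nhds (D * -D)) :=
    (hasDerivAt_iff_tendsto_slope.1 he).const_mul D
  have h2 : D * -D < 0 := by nlinarith [mul_self_pos.2 hD]
  have h3 := h1.eventually_lt_const h2
  rw [eventually_nhdsWithin_iff] at h3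
  filter_upwards [h3] with t ht htne
  have h4 := ht htne
  have h5 : D * t * e t = t ^ 2 * (D * slope e 0 t) := by
    rw [slope_def_field, h0]
    field_simp
    ring
  rw [h5]
  exact mul_neg_of_pos_of_neg (by positivity) h4

/-- The Hamiltonian-type curve through `(f k₀, k₀)`: along it the parametrised function
`((f K - c) u₁ + u) / δ` has derivative `u₁ K'`. -/
theorem exists_characteristic_curve {f : ℝ → ℝ} {u : ℝ → ℝ → ℝ} {δ k₀ D : ℝ} (hδ : 0 < δ)
    (hf : ContDiffOn ℝ (⊤ : ℕ∞) f (Ioi 0))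
    (hu : ContDiffOn ℝ (⊤ : ℕ∞) (fun p : ℝ × ℝ => u p.1 p.2) (Ioi 0 ×ˢ Ioi 0))
    (hu11 : ∀ c > (0 : ℝ), ∀ k > (0 : ℝ), pd11 u c k < 0)
    (hk₀ : 0 < k₀) (hfk₀ : 0 < f k₀)
    (hD : D = (δ - deriv f k₀) * pd1 u (f k₀) k₀ - pd2 u (f k₀) k₀) (hD0 : D ≠ 0) :
    ∃ c K : ℝ → ℝ, ∃ ε > 0, c 0 = f k₀ ∧ K 0 = k₀ ∧
      (∀ t ∈ Ioo (-ε) ε, 0 < c t ∧ 0 < K t) ∧ InjOn c (Ioo (-ε) ε) ∧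
      ContDiffOn ℝ 1 K (Ioo (-ε) ε) ∧
      ContDiffOn ℝ 1 (fun t => pd1 u (c t) (K t)) (Ioo (-ε) ε) ∧
      (∀ t ∈ Ioo (-ε) ε, t ≠ 0 → 0 < D * t * deriv K t) ∧
      ∀ t ∈ Ioo (-ε) ε,
        HasDerivAt (fun t => ((f (K t) - c t) * pd1 u (c t) (K t) + u (c t) (K t)) / δ)
          (pd1 u (c t) (K t) * deriv K t) t := by
  set Ω : Set (ℝ × ℝ) := Ioi 0 ×ˢ Ioi 0
  have hΩ : IsOpen Ω := isOpen_Ioi.prod isOpen_Ioi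
  have hu1 := contDiffOn_pd1 hΩ hu
  have hu2 := contDiffOn_pd2 hΩ hu
  have hu1' : ContDiffOn ℝ (⊤ : ℕ∞) (fun p : ℝ × ℝ => pd11 u p.1 p.2) Ω := contDiffOn_pd1 hΩ hu1
  have hu12 := contDiffOn_pd2 hΩ hu1
  have hsnd : MapsTo Prod.snd Ω (Ioi (0 : ℝ)) := fun p hp => hp.2
  have hf' : ContDiffOn ℝ (⊤ : ℕ∞) (deriv f) (Ioi 0) := hf.deriv_of_isOpen isOpen_Ioi (by simp)
  have hfΩ : ContDiffOn ℝ (⊤ : ℕ∞) (fun p : ℝ × ℝ => f p.2 - p.1) Ω :=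
    (hf.comp contDiffOn_snd hsnd).sub contDiffOn_fst
  have hf'Ω : ContDiffOn ℝ (⊤ : ℕ∞) (fun p : ℝ × ℝ => δ - deriv f p.2) Ω :=
    contDiffOn_const.sub (hf'.comp contDiffOn_snd hsnd)
  let X₁ : ℝ × ℝ → ℝ := fun p => (δ - deriv f p.2) * pd1 u p.1 p.2 - pd2 u p.1 p.2 -
    (f p.2 - p.1) * pd2 (pd1 u) p.1 p.2
  let X₂ : ℝ × ℝ → ℝ := fun p => (f p.2 - p.1) * pd11 u p.1 p.2
  have hX₁ : ContDiffOn ℝ (⊤ : ℕ∞) X₁ Ω := ((hf'Ω.mul hu1).sub hu2).sub (hfΩ.mul hu12)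
  have hX₂ : ContDiffOn ℝ (⊤ : ℕ∞) X₂ Ω := hfΩ.mul hu1'
  have hp₀ : (f k₀, k₀) ∈ Ω := ⟨hfk₀, hk₀⟩
  have hX : ContDiffAt ℝ 1 (fun p => (X₁ p, X₂ p)) (f k₀, k₀) :=
    ((hX₁.prodMk hX₂).contDiffAt (hΩ.mem_nhds hp₀)).of_le (by exact_mod_cast le_top)
  obtain ⟨γ, hγ0, ε₀, hε₀, hγ⟩ :=
    hX.exists_forall_mem_closedBall_exists_eq_forall_mem_Ioo_hasDerivAt₀ 0
  have hγd0 := hγ 0 ⟨by linarith, by linarith⟩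
  have hX₁0 : X₁ (f k₀, k₀) = D := by simp [X₁, hD]
  have hX₂0 : X₂ (f k₀, k₀) = 0 := by simp [X₂]
  have hfd : ∀ k > 0, HasDerivAt f (deriv f k) k := fun k hk =>
    ((hf.differentiableOn (by simp)).differentiableAt (isOpen_Ioi.mem_nhds hk)).hasDerivAt
  have hcd : ∀ t ∈ Ioo (0 - ε₀) (0 + ε₀), HasDerivAt (fun t => (γ t).1) (X₁ (γ t)) t :=
    fun t ht => (hasFDerivAt_fst (𝕜 := ℝ) (p := γ t)).comp_hasDerivAt t (hγ t ht)
  have hKd : ∀ t ∈ Ioo (0 - ε₀) (0 + ε₀), HasDerivAt (fun t => (γ t).2) (X₂ (γ t)) t :=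
    fun t ht => (hasFDerivAt_snd (𝕜 := ℝ) (p := γ t)).comp_hasDerivAt t (hγ t ht)
  have h0mem : (0 : ℝ) ∈ Ioo (0 - ε₀) (0 + ε₀) := ⟨by linarith, by linarith⟩
  have he : HasDerivAt (fun t => f (γ t).2 - (γ t).1) (-D) 0 := by
    have h1 : HasDerivAt f (deriv f k₀) (γ 0).2 := by rw [hγ0]; exact hfd k₀ hk₀
    have := (h1.comp 0 (hKd 0 h0mem)).sub (hcd 0 h0mem)
    rw [hγ0, hX₁0, hX₂0] at this
    exact this.congr_deriv (by simp)
  have hev1 := he.eventually_mul_neg (by simp [hγ0]) hD0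
  have hγc : ContinuousAt γ 0 := hγd0.continuousAt
  have hev2 : ∀ᶠ t in nhds 0, γ t ∈ Ω := hγc.eventually (by rw [hγ0]; exact hΩ.mem_nhds hp₀)
  have hev3 : ∀ᶠ t in nhds 0, 0 < D * X₁ (γ t) := by
    have h1 : ContinuousAt X₁ (γ 0) := by
      rw [hγ0]; exact hX₁.continuousOn.continuousAt (hΩ.mem_nhds hp₀)
    have h2 : ContinuousAt (fun t => D * X₁ (γ t)) 0 :=
      continuousAt_const.mul (ContinuousAt.comp (f := γ) (g := X₁) h1 hγc)
    refine h2.eventually_const_lt ?_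
    simp only [hγ0, hX₁0]
    exact mul_self_pos.2 hD0
  obtain ⟨ε₁, hε₁, hball⟩ := Metric.eventually_nhds_iff.1 ((hev1.and hev2).and hev3)
  have hIε : ∀ t ∈ Ioo (-min ε₀ ε₁) (min ε₀ ε₁), t ∈ Ioo (0 - ε₀) (0 + ε₀) ∧ dist t 0 < ε₁ := by
    intro t ht
    have h := abs_lt.2 ht
    refine ⟨?_, by simpa using h.trans_le (min_le_right _ _)⟩
    rw [zero_sub, zero_add]
    exact abs_lt.1 (h.trans_le (min_le_left _ _))
  have hγcont : ContinuousOn γ (Ioo (-min ε₀ ε₁) (min ε₀ ε₁)) := fun t ht =>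
    (hγ t (hIε t ht).1).continuousAt.continuousWithinAt
  have hγΩ : MapsTo γ (Ioo (-min ε₀ ε₁) (min ε₀ ε₁)) Ω := fun t ht => (hball (hIε t ht).2).1.2
  have hγ1 : ContDiffOn ℝ 1 γ (Ioo (-min ε₀ ε₁) (min ε₀ ε₁)) := by
    rw [show (1 : WithTop ℕ∞) = 0 + 1 from rfl, contDiffOn_succ_iff_deriv_of_isOpen isOpen_Ioo]
    refine ⟨fun t ht => (hγ t (hIε t ht).1).differentiableAt.differentiableWithinAt, by simp, ?_⟩
    rw [contDiffOn_zero]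
    exact ((hX₁.prodMk hX₂).continuousOn.comp hγcont hγΩ).congr
      fun t ht => (hγ t (hIε t ht).1).deriv
  refine ⟨fun t => (γ t).1, fun t => (γ t).2, min ε₀ ε₁, lt_min hε₀ hε₁, by simp [hγ0],
    by simp [hγ0], fun t ht => hγΩ ht, ?_, contDiff_snd.comp_contDiffOn hγ1,
    (hu1.of_le (by exact_mod_cast le_top)).comp hγ1 hγΩ, ?_, ?_⟩
  · have hmono : StrictMonoOn (fun t => D * (γ t).1) (Ioo (-min ε₀ ε₁) (min ε₀ ε₁)) := by
      apply strictMonoOn_of_deriv_pos (convex_Ioo _ _)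
      · exact continuousOn_const.mul (continuous_fst.comp_continuousOn hγcont)
      · intro t ht
        rw [interior_Ioo] at ht
        rw [((hcd t (hIε t ht).1).const_mul D).deriv]
        exact (hball (hIε t ht).2).2
    exact fun s hs t ht hst => hmono.injOn hs ht (by simp only [hst])
  · intro t ht htne
    rw [(hKd t (hIε t ht).1).deriv]
    have h1 := (hball (hIε t ht).2).1.1 htne
    have h2 := hu11 _ (hγΩ ht).1 _ (hγΩ ht).2
    calc 0 < D * t * (f (γ t).2 - (γ t).1) * pd11 u (γ t).1 (γ t).2 := mul_pos_of_neg_of_neg h1 h2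
      _ = _ := by simp only [X₂]; ring
  · intro t ht
    have hc := hcd t (hIε t ht).1
    have hK := hKd t (hIε t ht).1
    have h1 := hasDerivAt_comp_pd hΩ hu hc hK (hγΩ ht)
    have h2 := hasDerivAt_comp_pd hΩ hu1 hc hK (hγΩ ht)
    have h3 := (hfd _ (hγΩ ht).2).comp t hK
    have h4 := (((h3.sub hc).mul h2).add h1).div_const δ
    refine h4.congr_deriv ?_
    rw [hK.deriv, div_eq_iff hδ.ne']
    simp only [X₁, X₂, pd11, Pi.sub_apply, Function.comp_apply]
    simp only [pd1]
    ring

theorem solPair_of_isBranch {f : ℝ → ℝ} {u φ : ℝ → ℝ → ℝ} {δ k₀ ε : ℝ} {c K : ℝ → ℝ}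
    {J : Set ℝ} {τ₁ τ₂ : ℝ → ℝ} (hδ : 0 < δ) (hε : 0 < ε)
    (hc0 : c 0 = f k₀) (hK0 : K 0 = k₀)
    (hφ : ∀ t ∈ Ioo (-ε) ε, φ (pd1 u (c t) (K t)) (K t) = c t) (hinj : InjOn c (Ioo (-ε) ε))
    (h₁ : IsBranch K (fun t => pd1 u (c t) (K t))
      (fun t => ((f (K t) - c t) * pd1 u (c t) (K t) + u (c t) (K t)) / δ) (Ico 0 ε) J τ₁)
    (h₂ : IsBranch (fun t => K (-t)) (fun t => pd1 u (c (-t)) (K (-t)))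
      (fun t => ((f (K (-t)) - c (-t)) * pd1 u (c (-t)) (K (-t)) + u (c (-t)) (K (-t))) / δ)
      (Ico 0 ε) J τ₂)
    (hJ : UniqueDiffOn ℝ J) (hJne : ∃ k ∈ J, k ≠ k₀) :
    SolPair f u φ δ k₀ J := by
  have hm₁ : ∀ k ∈ J, τ₁ k ∈ Ioo (-ε) ε := fun k hk =>
    ⟨by linarith [(h₁.mem k hk).1], (h₁.mem k hk).2⟩
  have hm₂ : ∀ k ∈ J, -τ₂ k ∈ Ioo (-ε) ε := fun k hk =>
    ⟨by linarith [(h₂.mem k hk).2], by linarith [(h₂.mem k hk).1]⟩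
  have hb₁ : τ₁ k₀ = 0 := hK0 ▸ h₁.base
  have hb₂ : τ₂ k₀ = 0 := by simpa [hK0] using h₂.base
  have hφ₁ : ∀ k ∈ J, φ (pd1 u (c (τ₁ k)) (K (τ₁ k))) k = c (τ₁ k) := fun k hk => by
    simpa only [h₁.right_inv k hk] using hφ _ (hm₁ k hk)
  have hφ₂ : ∀ k ∈ J, φ (pd1 u (c (-τ₂ k)) (K (-τ₂ k))) k = c (-τ₂ k) := fun k hk => by
    simpa only [h₂.right_inv k hk] using hφ _ (hm₂ k hk)
  have h0 : (0 : ℝ) ∈ Ioo (-ε) ε := ⟨by linarith, hε⟩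
  have hφ0 : φ (pd1 u (f k₀) k₀) k₀ = f k₀ := by simpa [hc0, hK0] using hφ 0 h0
  refine ⟨_, _, _, _, h₁.hasDerivWithinAt, h₁.continuousOn, h₂.hasDerivWithinAt, h₂.continuousOn,
    h₁.contDiffOn, h₂.contDiffOn, fun k hk => ?_, fun k hk => ?_, ?_, ?_, ?_, ?_, ?_, ?_, ?_⟩
  · rw [hφ₁ k hk, h₁.right_inv k hk, mul_div_cancel₀ _ hδ.ne']
  · have hk' : K (-τ₂ k) = k := h₂.right_inv k hk
    rw [hφ₂ k hk, hk', mul_div_cancel₀ _ hδ.ne']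
  · simp [hb₁, hc0, hK0]
  · simp [hb₂, hc0, hK0]
  · simp [hb₁, hc0, hK0]
  · simp [hb₂, hc0, hK0]
  · simpa [hb₁, hc0, hK0] using hφ0
  · simpa [hb₂, hc0, hK0] using hφ0
  · intro heq
    obtain ⟨k, hk, hne⟩ := hJne
    have hp := (hJ k hk).eq_deriv _ (h₁.hasDerivWithinAt k hk)
      ((h₂.hasDerivWithinAt k hk).congr heq (heq hk))
    have hc : c (τ₁ k) = c (-τ₂ k) := by rw [← hφ₁ k hk, ← hφ₂ k hk, hp]
    have hτ := hinj (hm₁ k hk) (hm₂ k hk) hc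
    have h3 : τ₁ k = 0 := by linarith [(h₁.mem k hk).1, (h₂.mem k hk).1]
    exact hne (by rw [← h₁.right_inv k hk, h3, hK0])

/-- Two one-sided solutions of the limiting HJB problem.
If `f'(k∞) ≠ δ − u₂'/u₁'` (at `(f(k∞),k∞)`), then the boundary-value problem (81)–(82)
has two distinct one-sided solutions; the half-interval is on the right of `k∞` if
`δ − f'(k∞) − u₂'/u₁' > 0` and on the left if it is negative. -/
theorem stmt_15
    (f : ℝ → ℝ) (u : ℝ → ℝ → ℝ) (δ : ℝ) (hδ : 0 < δ)
    (hf_conc : ConcaveOn ℝ (Set.Ici 0) f)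
    (hf_cont : ContinuousOn f (Set.Ici 0))
    (hf_smooth : ContDiffOn ℝ (⊤ : ℕ∞) f (Set.Ioi 0))
    (hf_inada0 : Tendsto (deriv f) (nhdsWithin 0 (Set.Ioi 0)) atTop)
    (hf_inada1 : ∃ L ≤ (0:ℝ), Tendsto (deriv f) atTop (nhds L))
    (hu_smooth : ContDiffOn ℝ (⊤ : ℕ∞) (fun p : ℝ × ℝ => u p.1 p.2) (Set.Ioi 0 ×ˢ Set.Ioi 0))
    (hu_mono : ∀ k > (0:ℝ), StrictMonoOn (fun c => u c k) (Set.Ioi 0))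
    (hu1_pos : ∀ c > (0:ℝ), ∀ k > (0:ℝ), 0 < pd1 u c k)
    (hu11 : ∀ c > (0:ℝ), ∀ k > (0:ℝ), pd11 u c k < 0)
    (φ : ℝ → ℝ → ℝ)
    (hφ : ∀ k > (0:ℝ), ∀ x > (0:ℝ), 0 < φ x k ∧ pd1 u (φ x k) k = x)
    (kinf : ℝ) (hkinf : 0 < kinf) (hfkinf : 0 < f kinf)
    (hne : deriv f kinf ≠
      δ - pd2 u (f kinf) kinf / pd1 u (f kinf) kinf) :
    ∃ a > (0:ℝ),
      (0 < δ - deriv f kinf - pd2 u (f kinf) kinf / pd1 u (f kinf) kinf →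
        SolPair f u φ δ kinf (Set.Ico kinf (kinf + a))) ∧
      (δ - deriv f kinf - pd2 u (f kinf) kinf / pd1 u (f kinf) kinf < 0 →
        SolPair f u φ δ kinf (Set.Ioc (kinf - a) kinf)) := by
  have hp : 0 < pd1 u (f kinf) kinf := hu1_pos _ hfkinf _ hkinf
  set A := δ - deriv f kinf - pd2 u (f kinf) kinf / pd1 u (f kinf) kinf with hA
  have hA0 : A ≠ 0 := fun h => hne (by linarith)
  obtain ⟨c, K, ε, hε, hc0, hK0, hpos, hinj, hK, hP, hsign, hQ⟩ :=
    exists_characteristic_curve (D := pd1 u (f kinf) kinf * A) hδ hf_smooth hu_smooth hu11 hkinf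
      hfkinf (by rw [hA]; field_simp) (mul_ne_zero hp.ne' hA0)
  have hφc : ∀ t ∈ Ioo (-ε) ε, φ (pd1 u (c t) (K t)) (K t) = c t := by
    intro t ht
    obtain ⟨hct, hKt⟩ := hpos t ht
    have hanti : StrictAntiOn (fun x => pd1 u x (K t)) (Ioi 0) := by
      refine strictAntiOn_of_deriv_neg (convex_Ioi _) ?_ ?_
      · exact fun x hx =>
          (differentiableAt_of_deriv_ne_zero (hu11 x hx _ hKt).ne).continuousAt.continuousWithinAt
      · rw [interior_Ioi]
        exact fun x hx => hu11 x hx _ hKt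
    have h := hφ (K t) hKt _ (hu1_pos _ hct _ hKt)
    exact hanti.injOn h.1 hct h.2
  have hsub : Ico 0 ε ⊆ Ioo (-ε) ε := fun t ht => ⟨by linarith [ht.1], ht.2⟩
  have hsub' : Ioo 0 ε ⊆ Ioo (-ε) ε := Ioo_subset_Ico_self.trans hsub
  have hneg : MapsTo (fun t : ℝ => -t) (Ico 0 ε) (Ioo (-ε) ε) := fun t ht =>
    ⟨by linarith [ht.2], by linarith [ht.1]⟩
  have hneg' : MapsTo (fun t : ℝ => -t) (Ioo 0 ε) (Ioo (-ε) ε) :=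
    hneg.mono_left Ioo_subset_Ico_self
  have hQc : ContinuousOn (fun t => ((f (K t) - c t) * pd1 u (c t) (K t) + u (c t) (K t)) / δ)
      (Ioo (-ε) ε) := fun t ht => (hQ t ht).continuousAt.continuousWithinAt
  have hcneg : ContinuousOn (fun t : ℝ => -t) (Ico 0 ε) := continuous_neg.continuousOn
  have hdneg : ContDiffOn ℝ 1 (fun t : ℝ => -t) (Ioo 0 ε) := contDiff_neg.contDiffOn
  have hKneg : ∀ t, deriv (fun s => K (-s)) t = -deriv K (-t) := fun t => deriv_comp_neg K t
  have hQneg : ∀ t ∈ Ioo 0 ε, HasDerivAt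
      (fun t => ((f (K (-t)) - c (-t)) * pd1 u (c (-t)) (K (-t)) + u (c (-t)) (K (-t))) / δ)
      (pd1 u (c (-t)) (K (-t)) * deriv (fun s => K (-s)) t) t := by
    intro t ht
    refine ((hQ (-t) (hneg' ht)).comp t (hasDerivAt_neg t)).congr_deriv ?_
    rw [hKneg]
    ring
  have hpA : ∀ t ∈ Ioo 0 ε, 0 < A * deriv K t := by
    intro t ht
    have h := hsign t (hsub' ht) ht.1.ne'
    have h' : 0 < (pd1 u (f kinf) kinf * t) * (A * deriv K t) := by linarith
    exact pos_of_mul_pos_right h' (mul_pos hp ht.1).le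
  have hpA' : ∀ t ∈ Ioo 0 ε, 0 < A * deriv (fun s => K (-s)) t := by
    intro t ht
    rw [hKneg]
    have h := hsign (-t) (hneg' ht) (neg_ne_zero.2 ht.1.ne')
    have h' : 0 < (pd1 u (f kinf) kinf * t) * (A * -deriv K (-t)) := by linarith
    exact pos_of_mul_pos_right h' (mul_pos hp ht.1).le
  rcases hA0.lt_or_gt with hlt | hgt
  · have h₁ := eventually_exists_isBranch_left hε (hK.continuousOn.mono hsub)
      (hP.continuousOn.mono hsub) (hQc.mono hsub) (hK.mono hsub') (hP.mono hsub')
      (fun t ht => neg_of_mul_pos_right (hpA t ht) hlt.le) fun t ht => hQ t (hsub' ht)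
    have h₂ := eventually_exists_isBranch_left hε (hK.continuousOn.comp hcneg hneg)
      (hP.continuousOn.comp hcneg hneg) (hQc.comp hcneg hneg) (hK.comp hdneg hneg')
      (hP.comp hdneg hneg') (fun t ht => neg_of_mul_pos_right (hpA' t ht) hlt.le) hQneg
    obtain ⟨a, ⟨⟨τ₁, hτ₁⟩, τ₂, hτ₂⟩, ha⟩ := ((h₁.and h₂).and self_mem_nhdsWithin).exists
    have ha' : (0 : ℝ) < a := ha
    simp only [Function.comp_apply, neg_zero, hK0] at hτ₁ hτ₂
    refine ⟨a, ha, fun h => absurd h hlt.not_gt, fun _ =>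
      solPair_of_isBranch hδ hε hc0 hK0 hφc hinj hτ₁ hτ₂ (uniqueDiffOn_Ioc _ _)
        ⟨kinf - a / 2, ⟨by linarith, by linarith⟩, by linarith⟩⟩
  · have h₁ := eventually_exists_isBranch_right hε (hK.continuousOn.mono hsub)
      (hP.continuousOn.mono hsub) (hQc.mono hsub) (hK.mono hsub') (hP.mono hsub')
      (fun t ht => pos_of_mul_pos_right (hpA t ht) hgt.le) fun t ht => hQ t (hsub' ht)
    have h₂ := eventually_exists_isBranch_right hε (hK.continuousOn.comp hcneg hneg)
      (hP.continuousOn.comp hcneg hneg) (hQc.comp hcneg hneg) (hK.comp hdneg hneg')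
      (hP.comp hdneg hneg') (fun t ht => pos_of_mul_pos_right (hpA' t ht) hgt.le) hQneg
    obtain ⟨a, ⟨⟨τ₁, hτ₁⟩, τ₂, hτ₂⟩, ha⟩ := ((h₁.and h₂).and self_mem_nhdsWithin).exists
    have ha' : (0 : ℝ) < a := ha
    simp only [Function.comp_apply, neg_zero, hK0] at hτ₁ hτ₂
    refine ⟨a, ha, fun _ =>
      solPair_of_isBranch hδ hε hc0 hK0 hφc hinj hτ₁ hτ₂ (uniqueDiffOn_Ico _ _)
        ⟨kinf + a / 2, ⟨by linarith, by linarith⟩, by linarith⟩,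
      fun h => absurd h hgt.not_gt⟩
end

section
/- (Value of V′ at the limit point) Suppose V and W are differentiable at k∞ and satisfy equation (35) on a neighborhood of k∞ together with the boundary values (37) and (38) at k∞. Then V′(k∞) = u₁′(f(k∞),k∞) + ((1−λ)/λ)·U₁′(f(k∞),k∞). -/
open Filter Set

theorem pd1_strictAntiOn {u : ℝ → ℝ → ℝ} {k : ℝ} (h : ∀ c > (0 : ℝ), pd11 u c k < 0) :
    StrictAntiOn (fun c => pd1 u c k) (Ioi 0) := by
  refine strictAntiOn_of_deriv_neg (convex_Ioi 0) (fun c hc => ?_) (fun c hc => ?_)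
  · exact (differentiableAt_of_deriv_ne_zero (h c hc).ne).continuousAt.continuousWithinAt
  · rw [interior_Ioi] at hc
    exact h c hc

theorem hasDerivAt_pd1 {u : ℝ → ℝ → ℝ} {c k : ℝ}
    (hu : ContDiffOn ℝ (⊤ : ℕ∞) (fun p : ℝ × ℝ => u p.1 p.2) (Ioi 0 ×ˢ Ioi 0))
    (hc : 0 < c) (hk : 0 < k) : HasDerivAt (fun x => u x k) (pd1 u c k) c := by
  have hd : DifferentiableAt ℝ (fun p : ℝ × ℝ => u p.1 p.2) (c, k) :=
    (hu.contDiffAt (prod_mem_nhds (Ioi_mem_nhds hc) (Ioi_mem_nhds hk))).differentiableAt (by simp)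
  have hg : DifferentiableAt ℝ (fun x : ℝ => (x, k)) c := by fun_prop
  exact (DifferentiableAt.comp (f := fun x : ℝ => (x, k)) c hd hg).hasDerivAt

/-- If `g'` is injective on `(0, ∞)`, then `c ↦ g c - g' p * c` takes its value at `p` only
at `p`. -/
theorem eq_of_tangent_eq {g g' : ℝ → ℝ} (hg : ∀ c > (0 : ℝ), HasDerivAt g (g' c) c)
    (hinj : InjOn g' (Ioi 0)) {p q : ℝ} (hp : 0 < p) (hq : 0 < q)
    (h : (q - p) * g' p + g p = g q) : p = q := by
  have hd : ∀ c > (0 : ℝ), HasDerivAt (fun c => g c - g' p * c) (g' c - g' p) c := fun c hc => by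
    simpa only [mul_one, Pi.sub_def, id] using (hg c hc).sub ((hasDerivAt_id c).const_mul (g' p))
  have hrolle : ∀ r s : ℝ, 0 < r → r < s → g r - g' p * r = g s - g' p * s →
      ∃ c ∈ Ioo r s, g' c = g' p := fun r s hr hrs hv => by
    obtain ⟨c, hc, hc0⟩ := exists_hasDerivAt_eq_zero hrs
      (fun c hc => (hd c (hr.trans_le hc.1)).continuousAt.continuousWithinAt) hv
      (fun c hc => hd c (hr.trans hc.1))
    exact ⟨c, hc, sub_eq_zero.mp hc0⟩
  rcases lt_trichotomy p q with hpq | hpq | hpq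
  · obtain ⟨c, hc, he⟩ := hrolle p q hp hpq (by linarith)
    exact absurd (hinj (hp.trans hc.1) hp he) hc.1.ne'
  · exact hpq
  · obtain ⟨c, hc, he⟩ := hrolle q p hq hpq (by linarith)
    exact absurd (hinj (hq.trans hc.1) hp he) hc.2.ne

/-- Value of `V'` at the limit point. If `V`, `W` are differentiable
at `k∞` and satisfy equation (35) on a neighborhood of `k∞` together with the boundary
values (37)–(38), then `V'(k∞) = u₁'(f(k∞),k∞) + ((1−λ)/λ)·U₁'(f(k∞),k∞)`. -/
theorem stmt_18
    (f : ℝ → ℝ) (u U : ℝ → ℝ → ℝ) (δ₁ δ₂ lam : ℝ)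
    (hδ : δ₂ < δ₁) (hδ₂ : 0 < δ₂) (hlam0 : 0 < lam) (hlam1 : lam < 1)
    (a b : ℝ) (ha : a = (δ₁ + δ₂) / 2) (hb : b = (δ₁ - δ₂) / 2)
    (hf_conc : ConcaveOn ℝ (Set.Ici 0) f)
    (hf_cont : ContinuousOn f (Set.Ici 0))
    (hf_smooth : ContDiffOn ℝ (⊤ : ℕ∞) f (Set.Ioi 0))
    (hf_inada0 : Tendsto (deriv f) (nhdsWithin 0 (Set.Ioi 0)) atTop)
    (hf_inada1 : ∃ L ≤ (0:ℝ), Tendsto (deriv f) atTop (nhds L))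
    (hu_smooth : ContDiffOn ℝ (⊤ : ℕ∞) (fun p : ℝ × ℝ => u p.1 p.2) (Set.Ioi 0 ×ˢ Set.Ioi 0))
    (hU_smooth : ContDiffOn ℝ (⊤ : ℕ∞) (fun p : ℝ × ℝ => U p.1 p.2) (Set.Ioi 0 ×ˢ Set.Ioi 0))
    (hu_mono : ∀ k > (0:ℝ), StrictMonoOn (fun c => u c k) (Set.Ioi 0))
    (hU_mono : ∀ k > (0:ℝ), StrictMonoOn (fun c => U c k) (Set.Ioi 0))
    (hu11 : ∀ c > (0:ℝ), ∀ k > (0:ℝ), pd11 u c k < 0)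
    (hU11 : ∀ c > (0:ℝ), ∀ k > (0:ℝ), pd11 U c k < 0)
    (φ : ℝ → ℝ → ℝ)
    (hφ : ∀ k > (0:ℝ), ∀ x > (0:ℝ),
      0 < φ x k ∧ pd1 u (φ x k) k + (1 - lam) / lam * pd1 U (φ x k) k = x)
    (kinf : ℝ) (hkinf : 0 < kinf) (hfkinf : 0 < f kinf)
    (N : Set ℝ) (hN : N ∈ nhds kinf)
    (V W : ℝ → ℝ)
    (hVd : DifferentiableAt ℝ V kinf) (hWd : DifferentiableAt ℝ W kinf)
    (hVpos : ∀ k ∈ N, 0 < deriv V k)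
    -- equation (35) on the neighborhood N
    (h35 : ∀ k ∈ N,
      (f k - φ (deriv V k) k) * deriv V k + u (φ (deriv V k) k) k +
        (1 - lam) / lam * U (φ (deriv V k) k) k = a * V k + b * W k)
    -- boundary values (37) and (38)
    (h37 : V kinf = u (f kinf) kinf / δ₁ + (1 - lam) / (lam * δ₂) * U (f kinf) kinf)
    (h38 : W kinf = u (f kinf) kinf / δ₁ - (1 - lam) / (lam * δ₂) * U (f kinf) kinf) :
    deriv V kinf = pd1 u (f kinf) kinf + (1 - lam) / lam * pd1 U (f kinf) kinf := by
  have hk := mem_of_mem_nhds hN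
  have hm : 0 < (1 - lam) / lam := div_pos (sub_pos.mpr hlam1) hlam0
  obtain ⟨hp, hfoc⟩ := hφ kinf hkinf _ (hVpos kinf hk)
  have hδ₁ : δ₁ ≠ 0 := (hδ₂.trans hδ).ne'
  have hval : a * V kinf + b * W kinf =
      u (f kinf) kinf + (1 - lam) / lam * U (f kinf) kinf := by
    rw [h37, h38, ha, hb]
    field_simp
    ring
  have hanti : StrictAntiOn
      (fun c => pd1 u c kinf + (1 - lam) / lam * pd1 U c kinf) (Ioi 0) :=
    (pd1_strictAntiOn fun c hc => hu11 c hc kinf hkinf).add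
      fun c hc d hd hcd => mul_lt_mul_of_pos_left
        (pd1_strictAntiOn (fun c hc => hU11 c hc kinf hkinf) hc hd hcd) hm
  have hpq := eq_of_tangent_eq
    (g := fun c => u c kinf + (1 - lam) / lam * U c kinf)
    (fun c hc => (hasDerivAt_pd1 hu_smooth hc hkinf).add
      ((hasDerivAt_pd1 hU_smooth hc hkinf).const_mul _))
    hanti.injOn hp hfkinf (by
      have h := h35 kinf hk
      rw [hval] at h
      simp only [hfoc]
      linarith)
  rw [hpq] at hfoc
  exact hfoc.symm
end

section
/- (Closed form for the slope of the equilibrium strategy at the limit point) Let 0<λ<1, δ₁>δ₂>0, and let F, p, P, q, Q be real numbers with p>0, P>0 (representing f′(k∞), u₁′, U₁′, u₂′, U₂′ at (f(k∞),k∞)). Define y = p + ((1−λ)/λ)P, ḡ = [λδ₁p+(1−λ)δ₂P]/[λp+(1−λ)P] − [λq+(1−λ)Q]/[λp+(1−λ)P], and g̲ = [λp+(1−λ)P]/[(λ/δ₁)p+((1−λ)/δ₂)P] − [λδ₂q+(1−λ)δ₁Q]/[λδ₂p+(1−λ)δ₁P]. Suppose s ∈ ℝ satisfies δ₁ − F +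 s ≠ 0, δ₂ − F + s ≠ 0, ḡ ≠ F, and y = (p·s+q)/(δ₁−F+s) + ((1−λ)/λ)·(P·s+Q)/(δ₂−F+s). Then s = F − δ₁δ₂·[((1/δ₁)p + ((1−λ)/(λδ₂))P)·(g̲ − F)] / [(p + ((1−λ)/λ)P)·(ḡ − F)]. -/
/-- Closed form for the slope of the equilibrium strategy at the limit
point: the algebraic identity (c7) of the paper. Here `F, p, P, q, Q` stand for
`f'(k∞), u₁', U₁', u₂', U₂'` evaluated at `(f(k∞),k∞)`. -/
theorem stmt_19
    (lam δ₁ δ₂ : ℝ) (hlam0 : 0 < lam) (hlam1 : lam < 1)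
    (hδ : δ₂ < δ₁) (hδ₂ : 0 < δ₂)
    (F p P q Q : ℝ) (hp : 0 < p) (hP : 0 < P)
    (y gbar gunder : ℝ)
    (hy : y = p + (1 - lam) / lam * P)
    (hgbar : gbar = (lam * δ₁ * p + (1 - lam) * δ₂ * P) / (lam * p + (1 - lam) * P) -
      (lam * q + (1 - lam) * Q) / (lam * p + (1 - lam) * P))
    (hgunder : gunder = (lam * p + (1 - lam) * P) /
        (lam / δ₁ * p + (1 - lam) / δ₂ * P) -
      (lam * δ₂ * q + (1 - lam) * δ₁ * Q) / (lam * δ₂ * p + (1 - lam) * δ₁ * P))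
    (s : ℝ)
    (hs₁ : δ₁ - F + s ≠ 0) (hs₂ : δ₂ - F + s ≠ 0) (hgF : gbar ≠ F)
    (heq : y = (p * s + q) / (δ₁ - F + s) +
      (1 - lam) / lam * ((P * s + Q) / (δ₂ - F + s))) :
    s = F - δ₁ * δ₂ *
      ((1 / δ₁ * p + (1 - lam) / (lam * δ₂) * P) * (gunder - F)) /
      ((p + (1 - lam) / lam * P) * (gbar - F)) := by
  have hδ₁ : 0 < δ₁ := hδ₂.trans hδ
  have hl : 0 < 1 - lam := sub_pos.2 hlam1
  have hD : 0 < lam * p + (1 - lam) * P := by positivity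
  have hE : 0 < lam * δ₂ * p + (1 - lam) * δ₁ * P := by positivity
  have hgbar' : (lam * p + (1 - lam) * P) * gbar =
      lam * δ₁ * p + (1 - lam) * δ₂ * P - (lam * q + (1 - lam) * Q) := by
    rw [hgbar, ← sub_div, mul_div_cancel₀ _ hD.ne']
  have hharm : lam / δ₁ * p + (1 - lam) / δ₂ * P =
      (lam * δ₂ * p + (1 - lam) * δ₁ * P) / (δ₁ * δ₂) := by
    field_simp
  have hgunder' : (lam * δ₂ * p + (1 - lam) * δ₁ * P) * gunder =
      (lam * p + (1 - lam) * P) * (δ₁ * δ₂) - (lam * δ₂ * q + (1 - lam) * δ₁ * Q) := by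
    rw [hgunder, hharm, div_div_eq_mul_div, ← sub_div, mul_div_cancel₀ _ hE.ne']
  have hnum : δ₁ * δ₂ * ((1 / δ₁ * p + (1 - lam) / (lam * δ₂) * P) * (gunder - F)) =
      (lam * δ₂ * p + (1 - lam) * δ₁ * P) * (gunder - F) / lam := by
    field_simp
  have hden : (p + (1 - lam) / lam * P) * (gbar - F) =
      (lam * p + (1 - lam) * P) * (gbar - F) / lam := by
    field_simp
  have hgF' : gbar - F ≠ 0 := sub_ne_zero.2 hgF
  have hcleared : (lam * p + (1 - lam) * P) * ((δ₁ - F + s) * (δ₂ - F + s)) =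
      lam * (p * s + q) * (δ₂ - F + s) + (1 - lam) * (P * s + Q) * (δ₁ - F + s) := by
    rw [hy] at heq
    field_simp at heq
    linear_combination heq
  rw [hnum, hden, div_div_div_cancel_right₀ hlam0.ne', eq_sub_iff_add_eq, ← eq_sub_iff_add_eq',
    div_eq_iff (mul_ne_zero hD.ne' hgF')]
  linear_combination hgunder' + (s - F) * hgbar' + hcleared
end
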